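/- Let G = K_{a,b} with 3 ≤ a ≤ b, let k > 0, and let S be a k-PMU-defect-robust power dominating set of G of cardinality t. Then there exists an evenly distributed multiset S^e of vertices of G with the same total number of PMUs on side A and the same total number on side B as S, such that S^e is also a k-PMU-defect-robust power dominating set of G. -/

import Mathlib

/-- A set `T` of observed vertices is closed under the zero forcing rule:
if an observed vertex `v` has exactly one unobserved neighbor `w`,
then `w` becomes observed. -/
def ForcingClosed {V : Type*} (G : SimpleGraph V) (T : Set V) : Prop :=
  ∀ v ∈ T, ∀ w, G.Adj v w → (∀ u, G.Adj v u → u ∉ T → u = w) → w ∈ T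

/-- The set of vertices observed by the power domination process started at `S`:
the smallest set containing the closed neighborhood of `S` (domination step)
and closed under zero forcing. -/
def observedSet {V : Type*} (G : SimpleGraph V) (S : Set V) : Set V :=
  ⋂₀ {T : Set V | (∀ s ∈ S, s ∈ T ∧ ∀ w, G.Adj s w → w ∈ T) ∧ ForcingClosed G T}

/-- `S` is a power dominating set if the process observes every vertex. -/
def IsPDS {V : Type*} (G : SimpleGraph V) (S : Set V) : Prop :=
  observedSet G S = Set.univ

/-- The power domination number: minimum cardinality of a power dominating set. -/
noncomputable def pdn {V : Type*} (G : SimpleGraph V) : ℕ :=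
  sInf {n | ∃ S : Finset V, S.card = n ∧ IsPDS G ↑S}

/-- A multiset `S` of PMUs is a `k`-PMU-defect-robust power dominating set:
for every submultiset `F` of `S` with `|F| = k`, the underlying set of
`S - F` is a power dominating set. -/
def IsKrPDS {V : Type*} (G : SimpleGraph V) (k : ℕ) (S : Multiset V) : Prop :=
  letI := Classical.decEq V
  ∀ F : Multiset V, F ≤ S → Multiset.card F = k → IsPDS G {v | v ∈ S - F}

/-- The `k`-PMU-defect-robust power domination number. -/
noncomputable def rpdn {V : Type*} (G : SimpleGraph V) (k : ℕ) : ℕ :=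
  sInf {n | ∃ S : Multiset V, Multiset.card S = n ∧ IsKrPDS G k S}

/-- A multiset of PMUs on `K_{a,b}` is evenly distributed if, with `x` PMUs on side `A`
and `y` PMUs on side `B`, every vertex of `A` has multiplicity `⌊x/a⌋` or `⌊x/a⌋ + 1`
and every vertex of `B` has multiplicity `⌊y/b⌋` or `⌊y/b⌋ + 1`. -/
def EvenlyDistributed (a b : ℕ) (S : Multiset (Fin a ⊕ Fin b)) : Prop :=
  (∀ i : Fin a, S.count (Sum.inl i) = (∑ i' : Fin a, S.count (Sum.inl i')) / a ∨
      S.count (Sum.inl i) = (∑ i' : Fin a, S.count (Sum.inl i')) / a + 1) ∧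
  (∀ j : Fin b, S.count (Sum.inr j) = (∑ j' : Fin b, S.count (Sum.inr j')) / b ∨
      S.count (Sum.inr j) = (∑ j' : Fin b, S.count (Sum.inr j')) / b + 1)

theorem completeBipartiteGraph_adj_congr {α β : Type*} {u v : α ⊕ β}
    (h : ¬(completeBipartiteGraph α β).Adj u v) (w : α ⊕ β) :
    (completeBipartiteGraph α β).Adj u w ↔ (completeBipartiteGraph α β).Adj v w := by
  rcases u with u | u <;> rcases v with v | v <;> rcases w with w | w <;> simp_all

/-- A set power dominates a complete bipartite graph exactly when, for any two distinct vertices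
on the same side, it contains one of them or a vertex on the other side. -/
theorem isPDS_completeBipartiteGraph_iff {α β : Type*} [Nontrivial α] [Nontrivial β]
    (X : Set (α ⊕ β)) :
    IsPDS (completeBipartiteGraph α β) X ↔
      ∀ u v, u ≠ v → ¬(completeBipartiteGraph α β).Adj u v →
        ∃ w ∈ X, w = u ∨ w = v ∨ (completeBipartiteGraph α β).Adj u w := by
  constructor
  · intro h u v huv hadj
    by_contra! hX
    have hmem : u ∈ observedSet (completeBipartiteGraph α β) X := by
      rw [show observedSet _ X = Set.univ from h]
      trivial
    refine (hmem {w | w ≠ u ∧ w ≠ v} ⟨fun s hs => ?_, ?_⟩).1 rfl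
    · obtain ⟨hsu, hsv, hus⟩ := hX s hs
      refine ⟨⟨hsu, hsv⟩, fun w hw => ⟨?_, ?_⟩⟩
      · rintro rfl
        exact hus hw.symm
      · rintro rfl
        exact hus ((completeBipartiteGraph_adj_congr hadj s).2 hw.symm)
    · refine fun z _ w hzw hw => ⟨?_, ?_⟩
      · rintro rfl
        exact huv (hw v ((completeBipartiteGraph_adj_congr hadj z).1 hzw.symm).symm
          fun hv => hv.2 rfl).symm
      · rintro rfl
        exact huv (hw u ((completeBipartiteGraph_adj_congr hadj z).2 hzw.symm).symm
          fun hu => hu.1 rfl)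
  · refine fun h => Set.eq_univ_of_forall fun w T ⟨hdom, hforce⟩ => ?_
    by_contra hw
    have hX : ∀ v, w ≠ v → ¬(completeBipartiteGraph α β).Adj w v → v ∈ X := by
      intro v hv hadj
      obtain ⟨x, hx, rfl | rfl | hwx⟩ := h w v hv hadj
      · exact absurd (hdom x hx).1 hw
      · exact hx
      · exact absurd ((hdom x hx).2 w hwx.symm) hw
    obtain ⟨v, hv, hadj⟩ : ∃ v, w ≠ v ∧ ¬(completeBipartiteGraph α β).Adj w v := by
      rcases w with i | j
      · obtain ⟨i', hi⟩ := exists_ne i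
        exact ⟨Sum.inl i', by simpa using hi.symm, by simp⟩
      · obtain ⟨j', hj⟩ := exists_ne j
        exact ⟨Sum.inr j', by simpa using hj.symm, by simp⟩
    obtain ⟨z, hz⟩ : ∃ z, (completeBipartiteGraph α β).Adj w z := by
      rcases w with i | j
      · exact ⟨Sum.inr (Classical.arbitrary β), by simp⟩
      · exact ⟨Sum.inl (Classical.arbitrary α), by simp⟩
    have hzT : z ∈ T :=
      (hdom v (hX v hv hadj)).2 z ((completeBipartiteGraph_adj_congr hadj z).1 hz)
    refine hw (hforce z hzT w hz.symm fun u hzu hu => ?_)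
    by_contra huw
    refine hu (hdom u (hX u (Ne.symm huw) fun hwu => ?_)).1
    rcases w with w | w <;> rcases z with z | z <;> rcases u with u | u <;> simp_all

/-- Some element satisfying `p` survives every deletion of `k` elements exactly when more than
`k` elements satisfy `p`. -/
theorem Multiset.forall_exists_mem_sub_iff {V : Type*} [DecidableEq V] (S : Multiset V)
    (p : V → Prop) [DecidablePred p] {k : ℕ} (hk : k ≤ card S) :
    (∀ F ≤ S, card F = k → ∃ w ∈ S - F, p w) ↔ k < S.countP p := by
  constructor
  · intro h
    by_contra! hle
    have hsum : card (S.filter p) + card (S.filter fun w => ¬p w) = card S := by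
      rw [← card_add, filter_add_not]
    rw [countP_eq_card_filter] at hle
    obtain ⟨E, hmem⟩ := card_pos_iff_exists_mem.1
      (show 0 < card (powersetCard (k - card (S.filter p)) (S.filter fun w => ¬p w)) by
        rw [card_powersetCard]
        exact Nat.choose_pos (by omega))
    obtain ⟨hE, hcard⟩ := mem_powersetCard.1 hmem
    obtain ⟨w, hw, hpw⟩ := h (S.filter p + E)
      ((add_le_add_right hE _).trans_eq (filter_add_not p S)) (by rw [card_add]; omega)
    have hcount : 0 < count w (S - (S.filter p + E)) := count_pos.2 hw
    rw [count_sub, count_add, count_filter_of_pos hpw] at hcount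
    omega
  · intro h F hF hcard
    have hpos : 0 < (S - F).countP p := by
      rw [countP_sub hF]
      have := countP_le_card p F
      omega
    exact countP_pos.1 hpos

open Classical in
theorem isKrPDS_completeBipartiteGraph_iff {α β : Type*} [Nontrivial α] [Nontrivial β]
    {k : ℕ} {S : Multiset (α ⊕ β)} (hk : k ≤ Multiset.card S) :
    IsKrPDS (completeBipartiteGraph α β) k S ↔
      ∀ u v, u ≠ v → ¬(completeBipartiteGraph α β).Adj u v →
        k < S.countP fun w => w = u ∨ w = v ∨ (completeBipartiteGraph α β).Adj u w := by
  simp only [IsKrPDS, isPDS_completeBipartiteGraph_iff, Set.mem_ofPred_eq,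
    
    ← @Multiset.forall_exists_mem_sub_iff _ (Classical.decEq _) S _ _ _ hk]
  exact ⟨fun h u v huv hadj F hF hcard => h F hF hcard u v huv hadj,
    fun h F hF hcard u v huv hadj => h u v huv hadj F hF hcard⟩

theorem Multiset.countP_eq_sum_ite_count {V : Type*} [Fintype V] [DecidableEq V]
    (S : Multiset V) (p : V → Prop) [DecidablePred p] :
    S.countP p = ∑ v, if p v then S.count v else 0 := by
  rw [countP_eq_card_filter, ← sum_count_eq_card (s := Finset.univ) (by simp)]
  simp only [count_filter]

theorem Finset.sum_ite_eq_or_eq {ι : Type*} [Fintype ι] [DecidableEq ι] (f : ι → ℕ) {i j : ι}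
    (hij : i ≠ j) : (∑ l, if l = i ∨ l = j then f l else 0) = f i + f j := by
  rw [← sum_filter, show univ.filter (fun l => l = i ∨ l = j) = {i, j} by ext; simp,
    sum_pair hij]

/-- Robustness on a complete bipartite graph in terms of multiplicities. -/
theorem isKrPDS_completeBipartiteGraph_iff_count {α β : Type*} [Fintype α] [Fintype β]
    [DecidableEq α] [DecidableEq β] [Nontrivial α] [Nontrivial β]
    {k : ℕ} {S : Multiset (α ⊕ β)} (hk : k ≤ Multiset.card S) :
    IsKrPDS (completeBipartiteGraph α β) k S ↔
      (∀ i i' : α, i ≠ i' →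
        k < S.count (Sum.inl i) + S.count (Sum.inl i') + ∑ j : β, S.count (Sum.inr j)) ∧
      (∀ j j' : β, j ≠ j' →
        k < S.count (Sum.inr j) + S.count (Sum.inr j') + ∑ i : α, S.count (Sum.inl i)) := by
  classical
  rw [isKrPDS_completeBipartiteGraph_iff hk]
  simp only [Multiset.countP_eq_sum_ite_count, Fintype.sum_sum_type]
  constructor
  · intro h
    refine ⟨fun i i' hi => ?_, fun j j' hj => ?_⟩
    · simpa [Finset.sum_ite_eq_or_eq _ hi] using h (Sum.inl i) (Sum.inl i') (by simpa) (by simp)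
    · simpa [Finset.sum_ite_eq_or_eq _ hj, add_comm] using
        h (Sum.inr j) (Sum.inr j') (by simpa) (by simp)
  · rintro ⟨hl, hr⟩ (i | j) (i' | j') huv hadj
    · have hi : i ≠ i' := by simpa using huv
      simpa [Finset.sum_ite_eq_or_eq _ hi] using hl i i' hi
    · simp at hadj
    · simp at hadj
    · have hj : j ≠ j' := by simpa using huv
      simpa [Finset.sum_ite_eq_or_eq _ hj, add_comm] using hr j j' hj

/-- A balanced function maximizes the least sum of two values among all functions with the same
total. -/
theorem le_add_of_balanced {ι : Type*} [Fintype ι] [DecidableEq ι] {f g : ι → ℕ} {q T : ℕ}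
    (hsum : ∑ i, g i = ∑ i, f i) (hg : ∀ i, g i = q ∨ g i = q + 1)
    (hf : ∀ i j, i ≠ j → T ≤ f i + f j) {i j : ι} (hij : i ≠ j) : T ≤ g i + g j := by
  have split : ∀ (h : ι → ℕ) {u v : ι}, u ≠ v →
      ∑ l, h l = h u + h v + ∑ l ∈ Finset.univ \ {u, v}, h l := fun h u v huv => by
    rw [← Finset.sum_pair huv, add_comm, Finset.sum_sdiff (Finset.subset_univ _)]
  have card_rest : ∀ {u v : ι}, u ≠ v →
      (Finset.univ \ {u, v} : Finset ι).card = Fintype.card ι - 2 := fun {u v} huv => by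
    rw [Finset.card_sdiff_of_subset (Finset.subset_univ _), Finset.card_pair huv,
      Finset.card_univ]
  by_contra! hlt
  have hT : 2 * q + 1 ≤ T := by
    have := hg i
    have := hg j
    omega
  have : Nonempty ι := ⟨i⟩
  obtain ⟨u, hu⟩ := Finite.exists_min f
  obtain ⟨v, hv⟩ : ∃ v, u ≠ v := by
    by_cases h : u = i
    · exact ⟨j, h ▸ hij⟩
    · exact ⟨i, h⟩
  have hlower : (Finset.univ \ {u, v} : Finset ι).card • (q + 1) ≤
      ∑ l ∈ Finset.univ \ {u, v}, f l := by
    refine Finset.card_nsmul_le_sum _ _ _ fun l hl => ?_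
    have hlu : u ≠ l := by
      rintro rfl
      simp at hl
    have := hf u l hlu
    have := hu l
    omega
  have hupper : ∑ l ∈ Finset.univ \ {i, j}, g l ≤
      (Finset.univ \ {i, j} : Finset ι).card • (q + 1) := by
    refine Finset.sum_le_card_nsmul _ _ _ fun l _ => ?_
    have := hg l
    omega
  rw [card_rest hv] at hlower
  rw [card_rest hij] at hupper
  have := split f hv
  have := split g hij
  have := hf u v hv
  omega

theorem exists_balanced (n x : ℕ) (hn : 0 < n) :
    ∃ g : Fin n → ℕ, ∑ i, g i = x ∧ ∀ i, g i = x / n ∨ g i = x / n + 1 := by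
  refine ⟨fun i => x / n + if (i : ℕ) < x % n then 1 else 0, ?_, fun i => ?_⟩
  · rw [Finset.sum_add_distrib, Finset.sum_boole, Fin.card_filter_val_lt,
      min_eq_right (Nat.mod_lt x hn).le]
    simpa using Nat.div_add_mod x n
  · dsimp only
    split_ifs <;> simp

/-- Lemma: for `G = K_{a,b}` with `3 ≤ a ≤ b`, `k > 0`, and a `k`-PMU-defect-robust
power dominating set `S` of cardinality `t`, there is an evenly distributed multiset
`Sᵉ` with the same number of PMUs on each side that is also a `k`-rPDS. -/
theorem exists_evenlyDistributed_krPDS (a b k t : ℕ) (ha : 3 ≤ a) (hab : a ≤ b)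
    (hk : 0 < k) (S : Multiset (Fin a ⊕ Fin b))
    (hS : IsKrPDS (completeBipartiteGraph (Fin a) (Fin b)) k S)
    (ht : Multiset.card S = t) :
    ∃ Se : Multiset (Fin a ⊕ Fin b), EvenlyDistributed a b Se ∧
      (∑ i : Fin a, Se.count (Sum.inl i)) = (∑ i : Fin a, S.count (Sum.inl i)) ∧
      (∑ j : Fin b, Se.count (Sum.inr j)) = (∑ j : Fin b, S.count (Sum.inr j)) ∧
      IsKrPDS (completeBipartiteGraph (Fin a) (Fin b)) k Se := by
  obtain ⟨f, hfsum, hf⟩ := exists_balanced a (∑ i : Fin a, S.count (Sum.inl i)) (by omega)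
  obtain ⟨g, hgsum, hg⟩ := exists_balanced b (∑ j : Fin b, S.count (Sum.inr j)) (by omega)
  obtain ⟨Se, hSe⟩ : ∃ Se : Multiset (Fin a ⊕ Fin b), ∀ v, Se.count v = Sum.elim f g v :=
    ⟨Finsupp.toMultiset (Finsupp.equivFunOnFinite.symm (Sum.elim f g)), fun v => by
      simp [Finsupp.count_toMultiset]⟩
  have hl : ∀ i, Se.count (Sum.inl i) = f i := fun i => hSe _
  have hr : ∀ j, Se.count (Sum.inr j) = g j := fun j => hSe _
  have hcard : Multiset.card Se = Multiset.card S := by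
    rw [← Multiset.sum_count_eq_card (s := Finset.univ) (m := Se) (by simp),
      ← Multiset.sum_count_eq_card (s := Finset.univ) (m := S) (by simp)]
    simp only [Fintype.sum_sum_type, hl, hr, hfsum, hgsum]
  refine ⟨Se, ⟨?_, ?_⟩, by simpa only [hl] using hfsum, by simpa only [hr] using hgsum, ?_⟩
  · simpa only [hl, hfsum] using hf
  · simpa only [hr, hgsum] using hg
  rcases lt_or_ge (Multiset.card S) k with hlt | hle
  · intro F hF hFk
    have := Multiset.card_le_card hF
    omega
  have : Nontrivial (Fin a) := Fin.nontrivial_iff_two_le.2 (by omega)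
  have : Nontrivial (Fin b) := Fin.nontrivial_iff_two_le.2 (by omega)
  rw [isKrPDS_completeBipartiteGraph_iff_count hle] at hS
  rw [isKrPDS_completeBipartiteGraph_iff_count (hcard ▸ hle)]
  simp only [hl, hr, hfsum, hgsum]
  refine ⟨fun i i' hi => ?_, fun j j' hj => ?_⟩
  · have := le_add_of_balanced (T := k + 1 - ∑ j : Fin b, S.count (Sum.inr j)) hfsum hf
      (fun u v huv => by have := hS.1 u v huv; omega) hi
    omega
  · have := le_add_of_balanced (T := k + 1 - ∑ i : Fin a, S.count (Sum.inl i)) hgsum hg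
      (fun u v huv => by have := hS.2 u v huv; omega) hj
    omega
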